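/- Let g : ℝ³ → ℝ be smooth and axisymmetric, and define the azimuthal vector field h(x) = g(x)·e_θ(x) on U. Then on U the Hall term satisfies ∇×((∇×h)×h) = −(1/r)∂_z(g²)·e_θ = −2(g/r)·∂_z h, where ∂_z h is the componentwise derivative ∂_{x₃}h. -/

import Mathlib

open MeasureTheory

noncomputable section

abbrev R3 : Type := Fin 3 → ℝ

/-- cylindrical radius `r(x) = √(x₁² + x₂²)` -/
def rr (x : R3) : ℝ := Real.sqrt (x 0 ^ 2 + x 1 ^ 2)

/-- the region off the symmetry axis -/
def U : Set R3 := {x | 0 < rr x}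

/-- partial derivative in coordinate direction `i` -/
def pd (i : Fin 3) (u : R3 → ℝ) : R3 → ℝ := fun x => fderiv ℝ u x (Pi.single i 1)

/-- angular derivative `∂_θ u = x₁ ∂₂ u − x₂ ∂₁ u` -/
def dTheta (u : R3 → ℝ) : R3 → ℝ := fun x => x 0 * pd 1 u x - x 1 * pd 0 u x

/-- radial derivative `∂_r u = (x₁ ∂₁ u + x₂ ∂₂ u)/r` -/
def dR (u : R3 → ℝ) : R3 → ℝ := fun x => (x 0 * pd 0 u x + x 1 * pd 1 u x) / rr x

/-- vertical derivative `∂_z` -/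
def dZ (u : R3 → ℝ) : R3 → ℝ := pd 2 u

/-- the operator `(1/r)∂_r` -/
def dRr (u : R3 → ℝ) : R3 → ℝ := fun x => dR u x / rr x

/-- axisymmetric: `∂_θ f = 0` on `U` -/
def axisym (f : R3 → ℝ) : Prop := ∀ x ∈ U, dTheta f x = 0

/-- radial unit vector -/
def er (x : R3) : R3 := ![x 0 / rr x, x 1 / rr x, 0]
/-- azimuthal unit vector -/
def etheta (x : R3) : R3 := ![-(x 1) / rr x, x 0 / rr x, 0]
/-- vertical unit vector -/
def ez : R3 := ![0, 0, 1]

/-- the curl of a vector field -/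
def curl (F : R3 → R3) (x : R3) : R3 :=
  ![pd 1 (fun y => F y 2) x - pd 2 (fun y => F y 1) x,
    pd 2 (fun y => F y 0) x - pd 0 (fun y => F y 2) x,
    pd 0 (fun y => F y 1) x - pd 1 (fun y => F y 0) x]

/-- the cross product in `ℝ³` -/
def cross (a b : R3) : R3 :=
  ![a 1 * b 2 - a 2 * b 1, a 2 * b 0 - a 0 * b 2, a 0 * b 1 - a 1 * b 0]

lemma pd_mul' (i : Fin 3) {u v : R3 → ℝ} {x : R3} (hu : DifferentiableAt ℝ u x)
    (hv : DifferentiableAt ℝ v x) :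
    pd i (fun y => u y * v y) x = pd i u x * v x + u x * pd i v x := by
  unfold pd
  rw [fderiv_fun_mul hu hv]
  simp
  ring

lemma pd_add' (i : Fin 3) {u v : R3 → ℝ} {x : R3} (hu : DifferentiableAt ℝ u x)
    (hv : DifferentiableAt ℝ v x) :
    pd i (fun y => u y + v y) x = pd i u x + pd i v x := by
  unfold pd
  rw [fderiv_fun_add hu hv]
  simp

lemma pd_neg' (i : Fin 3) {u : R3 → ℝ} {x : R3} :
    pd i (fun y => - u y) x = - pd i u x := by
  unfold pd
  rw [fderiv_fun_neg]
  simp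

lemma pd_coord (i j : Fin 3) (x : R3) :
    pd i (fun y => y j) x = if j = i then 1 else 0 := by
  unfold pd
  rw [(hasFDerivAt_apply (𝕜 := ℝ) j x).fderiv]
  simp [Pi.single_apply]

lemma pd_zero' (i : Fin 3) (x : R3) : pd i (fun _ => (0 : ℝ)) x = 0 := by
  unfold pd
  simp

lemma pd_congr (i : Fin 3) {u v : R3 → ℝ} {x : R3} (hx : x ∈ U) (h : ∀ y ∈ U, u y = v y) :
    pd i u x = pd i v x := by
  have hU : IsOpen U := by
    unfold U rr
    exact isOpen_lt continuous_const (by fun_prop)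
  unfold pd
  have : u =ᶠ[nhds x] v := by
    filter_upwards [hU.mem_nhds hx] with y hy using h y hy
  rw [this.fderiv_eq]

lemma curl_congr {F G : R3 → R3} {x : R3} (hx : x ∈ U) (h : ∀ y ∈ U, F y = G y) :
    curl F x = curl G x := by
  have hF : ∀ i k, pd i (fun y => F y k) x = pd i (fun y => G y k) x :=
    fun i k => pd_congr i hx (fun y hy => by rw [h y hy])
  simp only [curl, hF]

lemma rr_sq (x : R3) : rr x ^ 2 = x 0 ^ 2 + x 1 ^ 2 := by
  unfold rr
  exact Real.sq_sqrt (by positivity)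

lemma q_pos {x : R3} (hx : x ∈ U) : 0 < x 0 ^ 2 + x 1 ^ 2 := by
  rw [← rr_sq]
  have : 0 < rr x := hx
  positivity

lemma rinv_diff {x : R3} (hx : x ∈ U) : DifferentiableAt ℝ (fun y => (rr y)⁻¹) x := by
  have h1 := (q_pos hx).ne'
  have h2 : rr x ≠ 0 := ne_of_gt hx
  unfold rr at *
  fun_prop (disch := assumption)

/-- `∂_i (1/r)` -/
lemma pd_rinv (i : Fin 3) {x : R3} (hx : x ∈ U) :
    pd i (fun y => (rr y)⁻¹) x = -(x 0 * pd i (fun y => y 0) x + x 1 * pd i (fun y => y 1) x)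
      * (rr x)⁻¹ ^ 3 := by
  have h2 : rr x ≠ 0 := ne_of_gt hx
  have hd := rinv_diff hx
  have d0 : DifferentiableAt ℝ (fun y : R3 => y 0) x := by fun_prop
  have d1 : DifferentiableAt ℝ (fun y : R3 => y 1) x := by fun_prop
  have key : pd i (fun y => ((rr y)⁻¹ * (rr y)⁻¹) * (y 0 * y 0 + y 1 * y 1)) x
      = pd i (fun y => 0 * y 0 + 1) x := by
    apply pd_congr i hx
    intro y hy
    have h3 : rr y ≠ 0 := ne_of_gt hy
    have := rr_sq y
    field_simp
    linarith
  have e0 : pd i (fun y => 0 * y 0 + 1) x = 0 := by simp [pd]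
  rw [e0, pd_mul' i (hd.fun_mul hd) ((d0.fun_mul d0).fun_add (d1.fun_mul d1)), pd_mul' i hd hd,
    pd_add' i (d0.fun_mul d0) (d1.fun_mul d1), pd_mul' i d0 d0, pd_mul' i d1 d1] at key
  have := rr_sq x
  have e : x 0 * x 0 + x 1 * x 1 = rr x ^ 2 := by linarith
  rw [e] at key
  field_simp at key ⊢
  linarith

lemma pd_diff {g : R3 → ℝ} (hg : ContDiff ℝ (⊤ : ℕ∞) g) (i : Fin 3) (x : R3) :
    DifferentiableAt ℝ (pd i g) x := by
  have h : ContDiff ℝ 1 (fderiv ℝ g) := hg.fderiv_right (by norm_cast)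
  have h' := (h.differentiable one_ne_zero) x
  unfold pd
  exact h'.clm_apply (differentiableAt_const _)

lemma pd_comm {g : R3 → ℝ} (hg : ContDiff ℝ (⊤ : ℕ∞) g) (i j : Fin 3) (x : R3) :
    pd i (pd j g) x = pd j (pd i g) x := by
  have h : ContDiff ℝ 1 (fderiv ℝ g) := hg.fderiv_right (by norm_cast)
  have h' := (h.differentiable one_ne_zero) x
  have hs : IsSymmSndFDerivAt ℝ g x :=
    (hg.contDiffAt).isSymmSndFDerivAt (by simp; norm_cast)
  unfold pd
  rw [fderiv_clm_apply h' (differentiableAt_const _),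
    fderiv_clm_apply h' (differentiableAt_const _)]
  simpa using hs (Pi.single i 1) (Pi.single j 1)

/-- derivatives of `g y_j / r` -/
lemma pd_term {g : R3 → ℝ} (hg : Differentiable ℝ g) (i j : Fin 3) {x : R3} (hx : x ∈ U) :
    pd i (fun y => g y * (y j / rr y)) x = pd i g x * (x j * (rr x)⁻¹)
      + g x * ((if j = i then 1 else 0) * (rr x)⁻¹ + x j * pd i (fun y => (rr y)⁻¹) x) := by
  have d : DifferentiableAt ℝ (fun y : R3 => y j) x := by fun_prop
  have hd := rinv_diff hx
  simp only [div_eq_mul_inv]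
  rw [pd_mul' i (hg x) (d.fun_mul hd), pd_mul' i d hd, pd_coord]

lemma term_diff {g : R3 → ℝ} (hg : Differentiable ℝ g) (j : Fin 3) {x : R3} (hx : x ∈ U) :
    DifferentiableAt ℝ (fun y => g y * (y j / rr y)) x := by
  have d : DifferentiableAt ℝ (fun y : R3 => y j) x := by fun_prop
  simp only [div_eq_mul_inv]
  exact (hg x).fun_mul (d.fun_mul (rinv_diff hx))

lemma hall_inner {g : R3 → ℝ} (hg : Differentiable ℝ g) (hax : axisym g) {y : R3} (hy : y ∈ U) :
    cross (curl (fun w => g w • etheta w) y) (g y • etheta y)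
      = ![-(g y * pd 0 g y + (g y * (y 0 / rr y)) * (g y * (rr y)⁻¹)),
          -(g y * pd 1 g y + (g y * (y 1 / rr y)) * (g y * (rr y)⁻¹)),
          -(g y * pd 2 g y)] := by
  have h2 : rr y ≠ 0 := ne_of_gt hy
  have hq := rr_sq y
  have ha : y 0 * pd 1 g y = y 1 * pd 0 g y := sub_eq_zero.mp (hax y hy)
  have e0 : ∀ i, pd i (fun w => g w * (-(w 1) / rr w)) y = - pd i (fun w => g w * (w 1 / rr w)) y := by
    intro i
    rw [← pd_neg']
    congr 1
    funext w
    ring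
  have hc : curl (fun w => g w • etheta w) y = ![-(pd 2 g y * (y 0 * (rr y)⁻¹)),
      -(pd 2 g y * (y 1 * (rr y)⁻¹)),
      (y 0 * pd 0 g y + y 1 * pd 1 g y) * (rr y)⁻¹ + g y * (rr y)⁻¹] := by
    ext k
    fin_cases k
    · simp [curl, etheta, pd_zero', pd_term hg _ _ hy, pd_rinv _ hy, pd_coord]
    · simp [curl, etheta, pd_zero', e0, pd_term hg _ _ hy, pd_rinv _ hy, pd_coord]
    · simp [curl, etheta, e0, pd_term hg _ _ hy, pd_rinv _ hy, pd_coord]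
      field_simp
      linear_combination (g y) * hq
  rw [hc]
  ext k
  fin_cases k
  · simp [cross, etheta]
    field_simp
    linear_combination (-g y * y 1) * ha + g y * pd 0 g y * hq
  · simp [cross, etheta]
    field_simp
    linear_combination (g y * y 0) * ha + g y * pd 1 g y * hq
  · simp [cross, etheta]
    field_simp
    linear_combination pd 2 g y * g y * hq

/-- for an azimuthal field `h = g·e_θ` with `g` smooth axisymmetric,
the Hall term satisfies `∇×((∇×h)×h) = −(1/r)∂_z(g²)·e_θ = −2(g/r)·∂_z h` on `U`. -/
theorem stmt_17 (g : R3 → ℝ) (hg : ContDiff ℝ (⊤ : ℕ∞) g) (hax : axisym g)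
    (x : R3) (hx : x ∈ U) :
    curl (fun y => cross (curl (fun w => g w • etheta w) y) (g y • etheta y)) x
      = -(dZ (fun y => (g y) ^ 2) x / rr x) • etheta x ∧
    -(dZ (fun y => (g y) ^ 2) x / rr x) • etheta x
      = (-2 * (g x / rr x)) • (fun i => pd 2 (fun y => g y * etheta y i) x) := by
  have hd : Differentiable ℝ g := hg.differentiable (by simp)
  have h2 : rr x ≠ 0 := ne_of_gt hx
  have hq := rr_sq x
  have ha : x 0 * pd 1 g x = x 1 * pd 0 g x := sub_eq_zero.mp (hax x hx)
  have hz : dZ (fun y => (g y) ^ 2) x = 2 * g x * pd 2 g x := by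
    simp only [dZ, pow_two]
    rw [pd_mul' 2 (hd x) (hd x)]
    ring
  rw [curl_congr hx (fun y hy => hall_inner hd hax hy)]
  have hA : ∀ i j, pd i (fun y => g y * pd j g y) x = pd i g x * pd j g x + g x * pd i (pd j g) x :=
    fun i j => pd_mul' i (hd x) (pd_diff hg j x)
  have hri := rinv_diff hx
  have hB : ∀ i j, pd i (fun y => -(g y * pd j g y + (g y * (y j / rr y)) * (g y * (rr y)⁻¹))) x
      = -(pd i g x * pd j g x + g x * pd i (pd j g) x +
        (pd i (fun y => g y * (y j / rr y)) x * (g x * (rr x)⁻¹) + (g x * (x j / rr x)) *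
          (pd i g x * (rr x)⁻¹ + g x * pd i (fun y => (rr y)⁻¹) x))) := by
    intro i j
    rw [pd_neg', pd_add' i ((hd x).fun_mul (pd_diff hg j x))
      ((term_diff hd j hx).fun_mul ((hd x).fun_mul hri)), hA,
      pd_mul' i (term_diff hd j hx) ((hd x).fun_mul hri), pd_mul' i (hd x) hri]
  rw [hz]
  constructor
  · ext k
    fin_cases k
    · simp [-neg_add_rev, curl, hB, hA, pd_neg', pd_term hd _ _ hx, pd_rinv _ hx, pd_coord, etheta,
        pd_comm hg 2 1]
      field_simp
      ring
    · simp [-neg_add_rev, curl, hB, hA, pd_neg', pd_term hd _ _ hx, pd_rinv _ hx, pd_coord, etheta,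
        pd_comm hg 2 0]
      field_simp
      ring
    · simp [-neg_add_rev, curl, hB, hA, pd_neg', pd_term hd _ _ hx, pd_rinv _ hx, pd_coord, etheta,
        pd_comm hg 1 0]
      field_simp
      linear_combination (2 * g x * rr x ^ 2) * ha
  · have e0 : pd 2 (fun w => g w * (-(w 1) / rr w)) x = - pd 2 (fun w => g w * (w 1 / rr w)) x := by
      rw [← pd_neg']
      congr 1
      funext w
      ring
    ext k
    fin_cases k
    · simp [etheta, e0, pd_term hd _ _ hx, pd_rinv _ hx, pd_coord]
      field_simp
    · simp [etheta, pd_term hd _ _ hx, pd_rinv _ hx, pd_coord]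
      field_simp
    · simp [etheta, pd_zero']
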